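/- Optimal real-valued codelengths for the convex combination of maximum and average codeword length: for k ∈ {0,…,n−1} and α ∈ [α_k, α_{k+1}) (taking the last interval to be [α_{n−1}, 1]), define l†_α(i) = −log_D w_α(i), i.e., l†_α(i) = −log_D((1−α)p_i) for 1 ≤ i ≤ n−k−1 and l†_α(i) = −log_D( (α + (1−α)·∑_{j=n−k}^{n} p_j)/(k+1) ) for n−k ≤ i ≤ n. Then l†_α(i) ≥ 0 for all i, ∑_{i=1}^n D^{−l†_α(i)} = 1, and for every l : {1,…,n} → ℝ with l_i ≥ 0 and ∑_{i=1}^n D^{−l_i} ≤ 1, one has α·max_i l†_α(i) + (1−α)·∑_i p_i l†_α(i) ≤ α·max_i l_i + (1−α)·∑_i p_i l_i. -/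

import Mathlib

/-- The breakpoints `α_k`: `α_0 = 0` and
`α_{k+1} = α_k + (1−α_k)·(p (n−k−1) − p (n−k)) / ((1/(k+1))·∑_{i=1}^{n−k−1} p i + p (n−k−1))`. -/
noncomputable def alphaB (n : ℕ) (p : ℕ → ℝ) : ℕ → ℝ
  | 0 => 0
  | k + 1 =>
      alphaB n p k + (1 - alphaB n p k) * (p (n - k - 1) - p (n - k)) /
        ((1 / ((k : ℝ) + 1)) * (∑ i ∈ Finset.Icc 1 (n - k - 1), p i) + p (n - k - 1))

/-- The weight vector on the interval `[α_k, α_{k+1})`: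
`w_α(i) = (1−α)·p i` for `1 ≤ i ≤ n−k−1` and
`w_α(i) = (α + (1−α)·∑_{j=n−k}^{n} p j)/(k+1)` for `n−k ≤ i ≤ n`. -/
noncomputable def wgt (n k : ℕ) (p : ℕ → ℝ) (α : ℝ) (i : ℕ) : ℝ :=
  if i ≤ n - k - 1 then (1 - α) * p i
  else (α + (1 - α) * ∑ j ∈ Finset.Icc (n - k) n, p j) / ((k : ℝ) + 1)

/-- `∑ w i * (-log_D (w i)) ≤ ∑ w i * l i` when `w` is a positive probability vector and `l`
satisfies the Kraft inequality. -/
theorem sum_mul_neg_logb_le_of_kraft {ι : Type*} (s : Finset ι) (w l : ι → ℝ) {D : ℝ} (hD : 1 < D)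
    (hw : ∀ i ∈ s, 0 < w i) (hsum : ∑ i ∈ s, w i = 1) (hl : ∑ i ∈ s, D ^ (-(l i)) ≤ 1) :
    ∑ i ∈ s, w i * (-Real.logb D (w i)) ≤ ∑ i ∈ s, w i * l i := by
  have hD0 : 0 < D := by linarith
  have hlog : 0 < Real.log D := Real.log_pos hD
  have key : ∀ i ∈ s, (w i * (-Real.logb D (w i)) - w i * l i) * Real.log D
      ≤ D ^ (-(l i)) - w i := by
    intro i hi
    have hwi := hw i hi
    have hq : 0 < D ^ (-(l i)) := Real.rpow_pos_of_pos hD0 _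
    have h := mul_le_mul_of_nonneg_left
      (Real.log_le_sub_one_of_pos (div_pos hq hwi)) hwi.le
    rw [Real.log_div hq.ne' hwi.ne', Real.log_rpow hD0] at h
    have e1 : (w i * (-Real.logb D (w i)) - w i * l i) * Real.log D
        = w i * (-(l i) * Real.log D - Real.log (w i)) := by
      rw [Real.logb]; field_simp; ring
    have e2 : w i * (D ^ (-(l i)) / w i - 1) = D ^ (-(l i)) - w i := by
      field_simp
    rw [e1, ← e2]
    exact h
  have h := Finset.sum_le_sum key
  rw [← Finset.sum_mul, Finset.sum_sub_distrib, Finset.sum_sub_distrib, hsum] at h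
  nlinarith

/-- Sufficient conditions for the lengths `-log_D (w i)` to minimize
`α * max l + (1 - α) * ∑ p i * l i` under the Kraft inequality. -/
theorem payoff_le_of_kraft {ι : Type*} (s : Finset ι) (hs : s.Nonempty) (p w lopt l : ι → ℝ)
    {D α : ℝ} (hD : 1 < D) (hp : ∑ i ∈ s, p i = 1)
    (hw : ∀ i ∈ s, 0 < w i) (hsum : ∑ i ∈ s, w i = 1)
    (hle : ∀ i ∈ s, (1 - α) * p i ≤ w i)
    (hmin : ∀ i ∈ s, w i ≠ (1 - α) * p i → ∀ j ∈ s, w i ≤ w j)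
    (hlopt : ∀ i ∈ s, lopt i = -Real.logb D (w i)) (hl : ∑ i ∈ s, D ^ (-(l i)) ≤ 1) :
    α * s.sup' hs lopt + (1 - α) * ∑ i ∈ s, p i * lopt i ≤
      α * s.sup' hs l + (1 - α) * ∑ i ∈ s, p i * l i := by
  have expand : ∀ (f : ι → ℝ) (M : ℝ), α * M + (1 - α) * ∑ i ∈ s, p i * f i
      = ∑ i ∈ s, w i * f i + ∑ i ∈ s, (w i - (1 - α) * p i) * (M - f i) := by
    intro f M
    have : ∑ i ∈ s, (w i - (1 - α) * p i) * (M - f i)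
        = (∑ i ∈ s, w i) * M - (1 - α) * (∑ i ∈ s, p i) * M - ∑ i ∈ s, w i * f i
          + (1 - α) * ∑ i ∈ s, p i * f i := by
      simp only [Finset.mul_sum, Finset.sum_mul, ← Finset.sum_sub_distrib,
        ← Finset.sum_add_distrib]
      exact Finset.sum_congr rfl fun i _ => by ring
    rw [this, hp, hsum]
    ring
  rw [expand, expand]
  have hzero : ∑ i ∈ s, (w i - (1 - α) * p i) * (s.sup' hs lopt - lopt i) = 0 := by
    refine Finset.sum_eq_zero fun i hi => ?_
    by_cases hi' : w i = (1 - α) * p i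
    · rw [hi', sub_self, zero_mul]
    · have : s.sup' hs lopt = lopt i := by
        refine le_antisymm (Finset.sup'_le hs _ fun j hj => ?_) (Finset.le_sup' lopt hi)
        rw [hlopt i hi, hlopt j hj]
        exact neg_le_neg (Real.logb_le_logb_of_le hD (hw i hi) (hmin i hi hi' j hj))
      rw [this, sub_self, mul_zero]
  have hnonneg : 0 ≤ ∑ i ∈ s, (w i - (1 - α) * p i) * (s.sup' hs l - l i) :=
    Finset.sum_nonneg fun i hi =>
      mul_nonneg (sub_nonneg.2 (hle i hi)) (sub_nonneg.2 (Finset.le_sup' l hi))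
  have hgibbs := sum_mul_neg_logb_le_of_kraft s w l hD hw hsum hl
  have hcongr : ∑ i ∈ s, w i * lopt i = ∑ i ∈ s, w i * (-Real.logb D (w i)) :=
    Finset.sum_congr rfl fun i hi => by rw [hlopt i hi]
  linarith

theorem sum_Icc_one_add_sum_Icc {m n : ℕ} (h : m ≤ n) (f : ℕ → ℝ) :
    ∑ i ∈ Finset.Icc 1 m, f i + ∑ i ∈ Finset.Icc (m + 1) n, f i = ∑ i ∈ Finset.Icc 1 n, f i := by
  rw [← Finset.sum_union]
  · congr 1
    ext i
    simp only [Finset.mem_union, Finset.mem_Icc]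
    omega
  · rw [Finset.disjoint_left]
    intro i
    simp only [Finset.mem_Icc]
    omega

/-- Closed form of the breakpoints: `1 - α_k = 1 / (∑_{i ≤ n-k} p i + k * p (n-k))`. -/
theorem one_sub_alphaB_mul {n : ℕ} {p : ℕ → ℝ} (hpos : ∀ i, 1 ≤ i → i ≤ n → 0 < p i)
    (hsum : ∑ i ∈ Finset.Icc 1 n, p i = 1) (k : ℕ) (hk : k + 1 ≤ n) :
    (1 - alphaB n p k) * (∑ i ∈ Finset.Icc 1 (n - k), p i + k * p (n - k)) = 1 := by
  induction k with
  | zero => simp [alphaB, hsum]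
  | succ k ih =>
    obtain ⟨m, rfl⟩ : ∃ m, n = m + 1 + k := ⟨n - k - 1, by omega⟩
    have ih := ih (by omega)
    have e1 : m + 1 + k - k - 1 = m := by omega
    have e2 : m + 1 + k - k = m + 1 := by omega
    have e3 : m + 1 + k - (k + 1) = m := by omega
    rw [e2, Finset.sum_Icc_succ_top (by omega)] at ih
    rw [alphaB, e1, e2, e3]
    have hS : 0 ≤ ∑ i ∈ Finset.Icc 1 m, p i := Finset.sum_nonneg fun i hi => by
      rw [Finset.mem_Icc] at hi
      exact (hpos i hi.1 (by omega)).le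
    have hm : 0 < p m := hpos m (by omega) (by omega)
    set S := ∑ i ∈ Finset.Icc 1 m, p i
    have hk0 : (0 : ℝ) < (k : ℝ) + 1 := by positivity
    have hden : S + (k + 1) * p m ≠ 0 := by positivity
    have hd : (1 / ((k : ℝ) + 1)) * S + p m = (S + (k + 1) * p m) / (k + 1) := by
      field_simp
    rw [hd]
    push_cast
    field_simp
    linear_combination ih


/-- Optimal real-valued codelengths for the convex combination of
maximum and average codeword length: for `k ∈ {0,…,n−1}` and `α ∈ [α_k, α_{k+1})`
(last interval `[α_{n−1}, 1]`), the lengths `l†_α(i) = −log_D (w_α(i))` are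
nonnegative, satisfy the Kraft equality `∑ i, D^(−l†_α(i)) = 1`, and minimize the
pay-off `α·max_i l i + (1−α)·∑ i, p i · l i` over all nonnegative length vectors
satisfying the Kraft inequality. -/
theorem optimal_codelengths_max_average
    (n : ℕ) (hn : 2 ≤ n) (p : ℕ → ℝ)
    (hpos : ∀ i, 1 ≤ i → i ≤ n → 0 < p i)
    (hmono : ∀ i j, 1 ≤ i → i ≤ j → j ≤ n → p j ≤ p i)
    (hsum : ∑ i ∈ Finset.Icc 1 n, p i = 1)
    (D : ℕ) (hD : 2 ≤ D)
    (k : ℕ) (hk : k ≤ n - 1) (α : ℝ)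
    (hα1 : alphaB n p k ≤ α)
    (hα2 : if k < n - 1 then α < alphaB n p (k + 1) else α ≤ 1)
    (lopt : ℕ → ℝ)
    (hlopt : ∀ i, 1 ≤ i → i ≤ n → lopt i = - Real.logb D (wgt n k p α i)) :
    (∀ i, 1 ≤ i → i ≤ n → 0 ≤ lopt i) ∧
    (∑ i ∈ Finset.Icc 1 n, (D : ℝ) ^ (-(lopt i)) = 1) ∧
    (∀ l : ℕ → ℝ, (∀ i, 1 ≤ i → i ≤ n → 0 ≤ l i) →
      (∑ i ∈ Finset.Icc 1 n, (D : ℝ) ^ (-(l i)) ≤ 1) →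
      α * (Finset.Icc 1 n).sup' (Finset.nonempty_Icc.mpr (by omega)) lopt +
          (1 - α) * ∑ i ∈ Finset.Icc 1 n, p i * lopt i ≤
        α * (Finset.Icc 1 n).sup' (Finset.nonempty_Icc.mpr (by omega)) l +
          (1 - α) * ∑ i ∈ Finset.Icc 1 n, p i * l i) := by
  obtain ⟨m, rfl⟩ : ∃ m, n = m + 1 + k := ⟨n - k - 1, by omega⟩
  have e1 : m + 1 + k - k - 1 = m := by omega
  have e2 : m + 1 + k - k = m + 1 := by omega
  have hD1 : (1 : ℝ) < D := by exact_mod_cast hD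
  have hk0 : (0 : ℝ) < (k : ℝ) + 1 := by positivity
  have hS : 0 ≤ ∑ i ∈ Finset.Icc 1 m, p i := Finset.sum_nonneg fun i hi => by
    rw [Finset.mem_Icc] at hi
    exact (hpos i hi.1 (by omega)).le
  have hsplit := sum_Icc_one_add_sum_Icc (show m ≤ m + 1 + k by omega) p
  have hlast : 0 < p (m + 1) := hpos _ (by omega) (by omega)
  have hclosed := one_sub_alphaB_mul hpos hsum k (by omega)
  rw [e2, Finset.sum_Icc_succ_top (by omega)] at hclosed
  have hwl : ∀ i, i ≤ m → wgt (m + 1 + k) k p α i = (1 - α) * p i := by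
    intro i hi
    rw [wgt, e1, if_pos hi]
  have hwr : ∀ i, m < i → wgt (m + 1 + k) k p α i
      = (1 - (1 - α) * ∑ i ∈ Finset.Icc 1 m, p i) / ((k : ℝ) + 1) := by
    intro i hi
    rw [wgt, e1, e2, if_neg (by omega)]
    congr 1
    linear_combination (1 - α) * hsplit + (1 - α) * hsum
  set S := ∑ i ∈ Finset.Icc 1 m, p i
  set W := (1 - (1 - α) * S) / ((k : ℝ) + 1) with hW
  have hWmul : ((k : ℝ) + 1) * W = 1 - (1 - α) * S := by
    rw [hW]; field_simp
  have hupper : m ≠ 0 → 0 < 1 - α ∧ W ≤ (1 - α) * p m := by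
    intro hm0
    rw [if_pos (by omega)] at hα2
    have hclosed' := one_sub_alphaB_mul hpos hsum (k + 1) (by omega)
    rw [show m + 1 + k - (k + 1) = m by omega] at hclosed'
    push_cast at hclosed'
    have hm : 0 < p m := hpos m (by omega) (by omega)
    have hq : 0 < S + (k + 1) * p m := by positivity
    have hb : 0 < 1 - alphaB (m + 1 + k) p (k + 1) :=
      pos_of_mul_pos_left (hclosed'.symm ▸ one_pos) hq.le
    refine ⟨by linarith, le_of_mul_le_mul_left ?_ hk0⟩
    have := mul_le_mul_of_nonneg_right (sub_le_sub_left hα2.le 1) hq.le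
    rw [hWmul]
    linarith
  have hb0 : 0 ≤ 1 - α := by
    by_cases hm0 : m = 0
    · rw [if_neg (by omega)] at hα2
      linarith
    · exact (hupper hm0).1.le
  have hlower : (1 - α) * p (m + 1) ≤ W := by
    refine le_of_mul_le_mul_left ?_ hk0
    have hq : 0 ≤ S + p (m + 1) + k * p (m + 1) := by positivity
    have := mul_le_mul_of_nonneg_right (sub_le_sub_left hα1 1) hq
    rw [hWmul]
    linarith
  have hWpos : 0 < W := by
    rcases hb0.eq_or_lt with h | h
    · rw [hW, ← h]
      simpa using hk0
    · exact (mul_pos h hlast).trans_le hlower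
  have hwpos : ∀ i ∈ Finset.Icc 1 (m + 1 + k), 0 < wgt (m + 1 + k) k p α i := by
    intro i hi
    rw [Finset.mem_Icc] at hi
    rcases le_or_gt i m with h | h
    · rw [hwl i h]
      exact mul_pos (hupper (by omega)).1 (hpos i hi.1 hi.2)
    · rwa [hwr i h]
  have hwsum : ∑ i ∈ Finset.Icc 1 (m + 1 + k), wgt (m + 1 + k) k p α i = 1 := by
    rw [← sum_Icc_one_add_sum_Icc (show m ≤ m + 1 + k by omega),
      Finset.sum_congr rfl fun i hi => hwl i (Finset.mem_Icc.1 hi).2,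
      Finset.sum_congr rfl fun i hi => hwr i (Finset.mem_Icc.1 hi).1,
      ← Finset.mul_sum, Finset.sum_const, Nat.card_Icc,
      show m + 1 + k + 1 - (m + 1) = k + 1 by omega, nsmul_eq_mul]
    push_cast
    rw [hWmul]
    ring
  refine ⟨fun i h1 h2 => ?_, ?_, fun l _ hl => ?_⟩
  · have hi := Finset.mem_Icc.2 ⟨h1, h2⟩
    rw [hlopt i h1 h2, neg_nonneg]
    refine Real.logb_nonpos hD1 (hwpos i hi).le ?_
    rw [← hwsum]
    exact Finset.single_le_sum (fun j hj => (hwpos j hj).le) hi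
  · rw [← hwsum]
    refine Finset.sum_congr rfl fun i hi => ?_
    have hi' := Finset.mem_Icc.1 hi
    rw [hlopt i hi'.1 hi'.2, neg_neg, Real.rpow_logb (by linarith) hD1.ne' (hwpos i hi)]
  · refine payoff_le_of_kraft _ _ p (wgt (m + 1 + k) k p α) lopt l hD1 hsum hwpos hwsum ?_ ?_
      (fun i hi => hlopt i (Finset.mem_Icc.1 hi).1 (Finset.mem_Icc.1 hi).2) hl
    · intro i hi
      rw [Finset.mem_Icc] at hi
      rcases le_or_gt i m with h | h
      · exact (hwl i h).ge
      · rw [hwr i h]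
        exact (mul_le_mul_of_nonneg_left (hmono _ _ (by omega) h hi.2) hb0).trans hlower
    · intro i hi hne j hj
      rw [Finset.mem_Icc] at hj
      have hi' : m < i := not_le.1 fun h => hne (hwl i h)
      rw [hwr i hi']
      rcases le_or_gt j m with h | h
      · rw [hwl j h]
        exact (hupper (by omega)).2.trans
          (mul_le_mul_of_nonneg_left (hmono _ _ hj.1 h (by omega)) hb0)
      · exact (hwr j h).ge
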